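/- Let φ : X → ℝ be a normalized potential with summable variation and μ_φ its unique equilibrium state. Then for every n ≥ 1 and every a_1^n ∈ A^n, ζ_{μ_φ}(a_1^n) ≥ exp(−2 Σ_{k=1}^∞ var_k(φ)) · e^{inf φ} > 0; in particular inf_n inf_{a_1^n ∈ A^n} ζ_{μ_φ}(a_1^n) > 0. -/

import Mathlib

open MeasureTheory Filter Topology Set

namespace RTSpec

variable (A : Type*) [Fintype A] [TopologicalSpace A] [DiscreteTopology A]
  [MeasurableSpace A] [BorelSpace A]

/-- The sequence space `X = A^ℕ` (0-indexed: `x 0` is the paper's `x₁`). -/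
abbrev X := ℕ → A

/-- The shift map `θ`. -/
def shift : X A → X A := fun x n => x (n + 1)

/-- The cylinder `[a_1^n]` based on the word `w = a_1^n`. -/
def cyl {n : ℕ} (w : Fin n → A) : Set (X A) := {x | ∀ i : Fin n, x i.val = w i}

/-- Return time `R_n(x) = inf {k ≥ 2 : x_k^{k+n-1} = x_1^n}` (with `sInf ∅ = 0`). -/
noncomputable def retTime (n : ℕ) (x : X A) : ℕ := sInf {k | 2 ≤ k ∧ ∀ i < n, x (k - 1 + i) = x i}

/-- Hitting time `T_{a_1^n}(y) = inf {k ≥ 1 : y_k^{k+n-1} = a_1^n}`. -/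
noncomputable def hitTime {n : ℕ} (w : Fin n → A) (y : X A) : ℕ :=
  sInf {k | 1 ≤ k ∧ ∀ i : Fin n, y (k - 1 + i.val) = w i}

/-- Hitting/return time in the shifted sense: `inf {k ≥ 1 : θ^k y ∈ [a_1^n]}`. -/
noncomputable def hitTime' {n : ℕ} (w : Fin n → A) (y : X A) : ℕ :=
  sInf {k | 1 ≤ k ∧ ∀ i : Fin n, y (k + i.val) = w i}

/-- `τ(a_1^n) = inf {k ≥ 1 : [a_1^n] ∩ θ^{-k}[a_1^n] ≠ ∅}`, the smallest return time
of the cylinder `[a_1^n]`. -/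
noncomputable def tau {n : ℕ} (w : Fin n → A) : ℕ :=
  sInf {k | 1 ≤ k ∧ (cyl A w ∩ {y | ∀ i : Fin n, y (k + i.val) = w i}).Nonempty}

/-- `ζ_μ(a_1^n) = μ([a_1^n] ∩ {T_{a_1^n} ≠ τ(a_1^n)}) / μ([a_1^n])`. -/
noncomputable def zeta (μ : Measure (X A)) {n : ℕ} (w : Fin n → A) : ℝ :=
  (μ (cyl A w ∩ {y | hitTime' A w y ≠ tau A w})).toReal / (μ (cyl A w)).toReal

/-- A shift-invariant Borel probability measure. -/
def InvProb (η : Measure (X A)) : Prop :=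
  IsProbabilityMeasure η ∧ Measure.map (shift A) η = η

/-- The `n`-th term `-(1/n) Σ_{a_1^n} μ(a_1^n) log μ(a_1^n)` of the entropy sequence. -/
noncomputable def entSeq (μ : Measure (X A)) (n : ℕ) : ℝ :=
  -(1 / (n : ℝ)) * ∑ w : Fin n → A, (μ (cyl A w)).toReal * Real.log (μ (cyl A w)).toReal

/-- The entropy `h(μ)`, i.e. the limit of `entSeq` (which always exists for a
shift-invariant measure; we realize it as a liminf). -/
noncomputable def entropy (μ : Measure (X A)) : ℝ := atTop.liminf (entSeq A μ)

/-- Topological pressure `P(ψ) = sup_η {h(η) + ∫ ψ dη}`, the supremum running over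
all shift-invariant probability measures. -/
noncomputable def pressure (ψ : X A → ℝ) : ℝ :=
  sSup {r | ∃ η : Measure (X A), InvProb A η ∧ r = entropy A η + ∫ x, ψ x ∂η}

/-- `sup_η ∫ φ dη` over shift-invariant probability measures. -/
noncomputable def supInt (φ : X A → ℝ) : ℝ :=
  sSup {r | ∃ η : Measure (X A), InvProb A η ∧ r = ∫ x, φ x ∂η}

/-- `inf_η ∫ φ dη` over shift-invariant probability measures. -/
noncomputable def infInt (φ : X A → ℝ) : ℝ :=
  sInf {r | ∃ η : Measure (X A), InvProb A η ∧ r = ∫ x, φ x ∂η}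

/-- `var_n(φ) = sup {|φ(x) - φ(y)| : x_1^n = y_1^n}`. -/
noncomputable def Var (φ : X A → ℝ) (n : ℕ) : ℝ :=
  sSup {r | ∃ x y : X A, (∀ i < n, x i = y i) ∧ r = |φ x - φ y|}

/-- Prepending a symbol: `ax = (a, x_1, x_2, …)`. -/
def prepend (a : A) (x : X A) : X A := fun n => Nat.casesOn n a x

/-- A potential `φ` is normalized if `Σ_{a ∈ A} e^{φ(ax)} = 1` for all `x`. -/
def Normalized (φ : X A → ℝ) : Prop :=
  ∀ x : X A, ∑ a : A, Real.exp (φ (prepend A a x)) = 1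

/-- `μ` is an equilibrium state for `φ`: a probability measure fixed by the dual
transfer operator, i.e. `∫ L_φ f dμ = ∫ f dμ` for every continuous `f`. -/
def IsEqSt (φ : X A → ℝ) (μ : Measure (X A)) : Prop :=
  IsProbabilityMeasure μ ∧ ∀ f : X A → ℝ, Continuous f →
    ∫ x, (∑ a : A, Real.exp (φ (prepend A a x)) * f (prepend A a x)) ∂μ = ∫ x, f x ∂μ

/-- The `n`-th term `(1/n) log ∫ R_n^q dμ` of the return-time `L^q`-spectrum,
with values in `EReal` (the integral may be infinite). -/
noncomputable def RSeq (μ : Measure (X A)) (q : ℝ) (n : ℕ) : EReal :=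
  (((n : ℝ)⁻¹ : ℝ) : EReal) *
    ENNReal.log (∫⁻ x, ENNReal.ofReal ((retTime A n x : ℝ) ^ q) ∂μ)

/-- The `n`-th term `(1/n) log Σ_{a_1^n} μ(a_1^n)^{1-q}` of the `L^q`-spectrum of `μ`. -/
noncomputable def MSeq (μ : Measure (X A)) (q : ℝ) (n : ℕ) : ℝ :=
  (1 / (n : ℝ)) * Real.log (∑ w : Fin n → A, (μ (cyl A w)).toReal ^ (1 - q))

/-- `Λ^{(n)}(μ) = (1/n) log Σ_{a_1^n} (1 - ζ_μ(a_1^n)) μ(a_1^n)`. -/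
noncomputable def LamSeq (μ : Measure (X A)) (n : ℕ) : ℝ :=
  (1 / (n : ℝ)) * Real.log (∑ w : Fin n → A, (1 - zeta A μ w) * (μ (cyl A w)).toReal)

/-- `(1/n) log max_{a_1^n} μ(a_1^n)`. -/
noncomputable def gammaSeq (μ : Measure (X A)) (n : ℕ) : ℝ :=
  (1 / (n : ℝ)) * Real.log (⨆ w : Fin n → A, (μ (cyl A w)).toReal)

/-- `μ` is φ-mixing with rate `ϕ`: `ϕ` decreases to `0` and for all `n, ℓ ≥ 1`,
all `S` in the σ-algebra generated by coordinates `1, …, n` with `μ S ≠ 0`, and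
all `T` in the σ-algebra generated by coordinates `n+ℓ, n+ℓ+1, …`,
`|μ(S ∩ T)/μ(S) - μ(T)| ≤ ϕ(ℓ)`. -/
def PhiMixing (μ : Measure (X A)) (ϕ : ℕ → ℝ) : Prop :=
  (∀ ℓ, 0 < ϕ ℓ) ∧ Antitone ϕ ∧ Tendsto ϕ atTop (nhds 0) ∧
  ∀ n ℓ : ℕ, 1 ≤ n → 1 ≤ ℓ →
    ∀ S T : Set (X A),
      MeasurableSet[MeasurableSpace.comap
        (fun x : X A => fun i : Fin n => x i.val) inferInstance] S →
      MeasurableSet[MeasurableSpace.comap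
        (fun x : X A => fun j : ℕ => x (n + ℓ - 1 + j)) inferInstance] T →
      μ S ≠ 0 →
      |(μ (S ∩ T)).toReal / (μ S).toReal - (μ T).toReal| ≤ ϕ ℓ

section

set_option linter.unusedSectionVars false

variable {A}

/-- The sequence `wx` obtained by putting the word `w` in front of `x`. -/
def concat : ∀ {n : ℕ}, (Fin n → A) → X A → X A
  | 0, _, x => x
  | _ + 1, w, x => prepend A (w 0) (concat (Fin.tail w) x)

/-- The Birkhoff sum `S_n φ(wx)` for a word `w` of length `n`. -/
def birkhoffConcat (φ : X A → ℝ) : ∀ {n : ℕ}, (Fin n → A) → X A → ℝ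
  | 0, _, _ => 0
  | _ + 1, w, x => φ (concat w x) + birkhoffConcat φ (Fin.tail w) x

theorem continuous_prepend (a : A) : Continuous (prepend A a) := by
  refine continuous_pi fun n => ?_
  cases n with
  | zero => exact continuous_const
  | succ n => exact continuous_apply n

theorem continuous_concat {n : ℕ} (w : Fin n → A) : Continuous (concat w) := by
  induction n with
  | zero => exact continuous_id
  | succ n ih => exact (continuous_prepend (w 0)).comp (ih (Fin.tail w))

theorem continuous_birkhoffConcat {φ : X A → ℝ} (hφ : Continuous φ) {n : ℕ} (w : Fin n → A) :
    Continuous (birkhoffConcat φ w) := by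
  induction n with
  | zero => exact continuous_const
  | succ n ih => exact (hφ.comp (continuous_concat w)).add (ih (Fin.tail w))

theorem concat_apply_of_lt {n : ℕ} (w : Fin n → A) (x : X A) {i : ℕ} (hi : i < n) :
    concat w x i = w ⟨i, hi⟩ := by
  induction n generalizing i with
  | zero => omega
  | succ n ih =>
    cases i with
    | zero => rfl
    | succ i => exact ih (Fin.tail w) (Nat.lt_of_succ_lt_succ hi)

theorem concat_apply_add {n : ℕ} (w : Fin n → A) (x : X A) (i : ℕ) :
    concat w x (n + i) = x i := by
  induction n with
  | zero => simp [concat]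
  | succ n ih =>
    rw [Nat.add_right_comm]
    exact ih (Fin.tail w)

theorem prepend_mem_cyl_iff {n : ℕ} (w : Fin (n + 1) → A) (a : A) (x : X A) :
    prepend A a x ∈ cyl A w ↔ a = w 0 ∧ x ∈ cyl A (Fin.tail w) :=
  Fin.forall_fin_succ

theorem isClopen_cyl {n : ℕ} (w : Fin n → A) : IsClopen (cyl A w) := by
  have h : cyl A w = ⋂ i : Fin n, (fun x : X A => x i.val) ⁻¹' {w i} := by
    ext x
    simp [cyl]
  rw [h]
  exact isClopen_iInter_of_finite fun i =>
    (isClopen_discrete {w i}).preimage (continuous_apply i.val)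

theorem integrable_of_continuous (μ : Measure (X A)) [IsFiniteMeasure μ] {f : X A → ℝ}
    (hf : Continuous f) : Integrable f μ :=
  hf.integrable_of_hasCompactSupport (HasCompactSupport.of_compactSpace f)

/-- Iterating the transfer operator along a word: `∫_{[w]} F dμ = ∫ e^{S_n φ(wx)} F(wx) dμ(x)`. -/
theorem IsEqSt.integral_indicator_cyl {φ : X A → ℝ} (hφ : Continuous φ) {μ : Measure (X A)}
    (hμ : IsEqSt A φ μ) {n : ℕ} (w : Fin n → A) {F : X A → ℝ} (hF : Continuous F) :
    ∫ x, (cyl A w).indicator F x ∂μ =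
      ∫ x, Real.exp (birkhoffConcat φ w x) * F (concat w x) ∂μ := by
  induction n generalizing F with
  | zero =>
    have h : cyl A w = univ := eq_univ_of_forall fun x i => i.elim0
    simp [h, birkhoffConcat, concat]
  | succ n ih =>
    let G : X A → ℝ := fun x => Real.exp (φ (prepend A (w 0) x)) * F (prepend A (w 0) x)
    have hG : Continuous G :=
      (Real.continuous_exp.comp (hφ.comp (continuous_prepend (w 0)))).mul
        (hF.comp (continuous_prepend (w 0)))
    calc ∫ x, (cyl A w).indicator F x ∂μ
        = ∫ x, (∑ a : A, Real.exp (φ (prepend A a x)) *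
            (cyl A w).indicator F (prepend A a x)) ∂μ :=
          (hμ.2 _ (hF.indicator (by simp [(isClopen_cyl w).frontier_eq]))).symm
      _ = ∫ x, (cyl A (Fin.tail w)).indicator G x ∂μ := by
          refine integral_congr_ae (Eventually.of_forall fun x => ?_)
          simp only
          rw [Finset.sum_eq_single (w 0)]
          · by_cases hx : x ∈ cyl A (Fin.tail w)
            · rw [indicator_of_mem ((prepend_mem_cyl_iff w _ x).2 ⟨rfl, hx⟩),
                indicator_of_mem hx]
            · rw [indicator_of_notMem fun h => hx ((prepend_mem_cyl_iff w _ x).1 h).2,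
                indicator_of_notMem hx, mul_zero]
          · intro a _ ha
            rw [indicator_of_notMem fun h => ha ((prepend_mem_cyl_iff w a x).1 h).1, mul_zero]
          · intro h
            exact absurd (Finset.mem_univ _) h
      _ = ∫ x, Real.exp (birkhoffConcat φ (Fin.tail w) x) * G (concat (Fin.tail w) x) ∂μ :=
          ih (Fin.tail w) hG
      _ = ∫ x, Real.exp (birkhoffConcat φ w x) * F (concat w x) ∂μ := by
          refine integral_congr_ae (Eventually.of_forall fun x => ?_)
          simp only [G, birkhoffConcat, concat, Real.exp_add]
          ring

theorem abs_sub_le_Var {φ : X A → ℝ} (hφ : Continuous φ) {n : ℕ} {x y : X A}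
    (h : ∀ i < n, x i = y i) : |φ x - φ y| ≤ Var A φ n := by
  refine le_csSup ?_ ⟨x, y, h, rfl⟩
  obtain ⟨C, hC⟩ := (isCompact_univ (X := X A)).exists_bound_of_continuousOn hφ.continuousOn
  refine ⟨C + C, ?_⟩
  rintro _ ⟨u, v, -, rfl⟩
  exact (norm_sub_le (φ u) (φ v)).trans (add_le_add (hC u (mem_univ u)) (hC v (mem_univ v)))

theorem Var_nonneg (φ : X A → ℝ) (n : ℕ) : 0 ≤ Var A φ n := by
  refine Real.sSup_nonneg ?_
  rintro _ ⟨x, y, -, rfl⟩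
  exact abs_nonneg _

theorem birkhoffConcat_sub_le {φ : X A → ℝ} (hφ : Continuous φ) {n : ℕ} (w : Fin n → A)
    (x y : X A) :
    birkhoffConcat φ w x - birkhoffConcat φ w y ≤ ∑ k ∈ Finset.range n, Var A φ (k + 1) := by
  induction n with
  | zero => simp [birkhoffConcat]
  | succ n ih =>
    rw [Finset.sum_range_succ]
    have h₁ := ih (Fin.tail w)
    have h₂ : φ (concat w x) - φ (concat w y) ≤ Var A φ (n + 1) :=
      (le_abs_self _).trans <| abs_sub_le_Var hφ fun i hi => by
        rw [concat_apply_of_lt w x hi, concat_apply_of_lt w y hi]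
    simp only [birkhoffConcat]
    linarith

theorem birkhoffConcat_sub_le_tsum {φ : X A → ℝ} (hφ : Continuous φ)
    (hvar : Summable fun n => Var A φ (n + 1)) {n : ℕ} (w : Fin n → A) (x y : X A) :
    birkhoffConcat φ w x - birkhoffConcat φ w y ≤ ∑' k : ℕ, Var A φ (k + 1) :=
  (birkhoffConcat_sub_le hφ w x y).trans
    (hvar.sum_le_tsum _ fun k _ => Var_nonneg φ (k + 1))

theorem IsEqSt.measureReal_cyl {φ : X A → ℝ} (hφ : Continuous φ) {μ : Measure (X A)}
    (hμ : IsEqSt A φ μ) {n : ℕ} (w : Fin n → A) :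
    μ.real (cyl A w) = ∫ x, Real.exp (birkhoffConcat φ w x) ∂μ := by
  have h := hμ.integral_indicator_cyl hφ w (F := fun _ => 1) continuous_const
  simp only [mul_one] at h
  rw [← h]
  exact (integral_indicator_one (isClopen_cyl w).isOpen.measurableSet).symm

theorem isClopen_coord_eq (n : ℕ) (b : A) : IsClopen {y : X A | y n = b} :=
  (isClopen_discrete {b}).preimage (continuous_apply n)

theorem IsEqSt.measureReal_cyl_inter_coord {φ : X A → ℝ} (hφ : Continuous φ)
    {μ : Measure (X A)} (hμ : IsEqSt A φ μ) {n : ℕ} (w : Fin n → A) (b : A) :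
    μ.real (cyl A w ∩ {y | y n = b}) =
      ∫ x, Real.exp (birkhoffConcat φ w x) * {y : X A | y 0 = b}.indicator 1 x ∂μ := by
  have hF : Continuous ({y : X A | y n = b}.indicator (1 : X A → ℝ)) :=
    continuous_one.indicator (by simp [(isClopen_coord_eq n b).frontier_eq])
  have h := hμ.integral_indicator_cyl hφ w hF
  simp only [indicator_indicator] at h
  rw [integral_indicator_one
    ((isClopen_cyl w).isOpen.measurableSet.inter (isClopen_coord_eq n b).isOpen.measurableSet)] at h
  rw [h]
  refine integral_congr_ae (Eventually.of_forall fun x => ?_)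
  have hx : concat w x ∈ {y : X A | y n = b} ↔ x ∈ {y : X A | y 0 = b} :=
    Eq.congr_left (concat_apply_add w x 0)
  by_cases h0 : x ∈ {y : X A | y 0 = b}
  · simp only [indicator_of_mem h0, indicator_of_mem (hx.2 h0), Pi.one_apply]
  · simp only [indicator_of_notMem h0, indicator_of_notMem (mt hx.1 h0)]

theorem IsEqSt.exp_iInf_le_measureReal_coord {φ : X A → ℝ} (hφ : Continuous φ)
    {μ : Measure (X A)} (hμ : IsEqSt A φ μ) (b : A) :
    Real.exp (⨅ x : X A, φ x) ≤ μ.real {y | y 0 = b} := by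
  have := hμ.1
  have hcyl : cyl A (fun _ : Fin 1 => b) = {y | y 0 = b} := by
    ext y
    simp [cyl]
  have hbdd : BddBelow (range φ) := (isCompact_range hφ).bddBelow
  rw [← hcyl, hμ.measureReal_cyl hφ]
  calc Real.exp (⨅ x : X A, φ x) = ∫ _, Real.exp (⨅ x : X A, φ x) ∂μ := by simp
    _ ≤ _ := integral_mono (integrable_const _)
      (integrable_of_continuous μ
        (Real.continuous_exp.comp (continuous_birkhoffConcat hφ _))) fun x => ?_
  simp only [birkhoffConcat, add_zero]
  exact Real.exp_le_exp.2 (ciInf_le hbdd _)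

theorem IsEqSt.measureReal_cyl_le {φ : X A → ℝ} (hφ : Continuous φ)
    (hvar : Summable fun n => Var A φ (n + 1)) {μ : Measure (X A)} (hμ : IsEqSt A φ μ)
    {n : ℕ} (w : Fin n → A) (z : X A) :
    μ.real (cyl A w) ≤
      Real.exp (∑' k : ℕ, Var A φ (k + 1)) * Real.exp (birkhoffConcat φ w z) := by
  have := hμ.1
  rw [hμ.measureReal_cyl hφ, ← Real.exp_add]
  calc _ ≤ ∫ _, Real.exp (∑' k : ℕ, Var A φ (k + 1) + birkhoffConcat φ w z) ∂μ :=
        integral_mono (integrable_of_continuous μ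
          (Real.continuous_exp.comp (continuous_birkhoffConcat hφ w))) (integrable_const _)
          fun x => Real.exp_le_exp.2 ?_
    _ = _ := by simp
  linarith [birkhoffConcat_sub_le_tsum hφ hvar w x z]

theorem IsEqSt.le_measureReal_cyl_inter_coord {φ : X A → ℝ} (hφ : Continuous φ)
    (hvar : Summable fun n => Var A φ (n + 1)) {μ : Measure (X A)} (hμ : IsEqSt A φ μ)
    {n : ℕ} (w : Fin n → A) (b : A) (z : X A) :
    Real.exp (-∑' k : ℕ, Var A φ (k + 1)) * Real.exp (birkhoffConcat φ w z) *
        Real.exp (⨅ x : X A, φ x) ≤ μ.real (cyl A w ∩ {y | y n = b}) := by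
  have := hμ.1
  have hF : Continuous ({y : X A | y 0 = b}.indicator (1 : X A → ℝ)) :=
    continuous_one.indicator (by simp [(isClopen_coord_eq 0 b).frontier_eq])
  rw [hμ.measureReal_cyl_inter_coord hφ, ← Real.exp_add]
  calc _ ≤ Real.exp (-∑' k : ℕ, Var A φ (k + 1) + birkhoffConcat φ w z) *
          μ.real {y | y 0 = b} := by
        gcongr
        exact hμ.exp_iInf_le_measureReal_coord hφ b
    _ = ∫ x, Real.exp (-∑' k : ℕ, Var A φ (k + 1) + birkhoffConcat φ w z) *
          {y : X A | y 0 = b}.indicator 1 x ∂μ := by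
        rw [integral_const_mul, integral_indicator_one (isClopen_coord_eq 0 b).isOpen.measurableSet]
    _ ≤ _ := integral_mono (integrable_of_continuous μ (continuous_const.mul hF))
        (integrable_of_continuous μ
          ((Real.continuous_exp.comp (continuous_birkhoffConcat hφ w)).mul hF)) fun x => ?_
  refine mul_le_mul_of_nonneg_right (Real.exp_le_exp.2 ?_)
    (indicator_nonneg (fun _ _ => zero_le_one) x)
  linarith [birkhoffConcat_sub_le_tsum hφ hvar w z x]

theorem tau_mem_Icc {n : ℕ} (hn : 1 ≤ n) (w : Fin n → A) : tau A w ∈ Icc 1 n := by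
  have hmem : n ∈ {k | 1 ≤ k ∧
      (cyl A w ∩ {y | ∀ i : Fin n, y (k + i.val) = w i}).Nonempty} := by
    refine ⟨hn, fun k => w ⟨k % n, Nat.mod_lt k hn⟩, fun i => ?_, fun i => ?_⟩
    · simp [Nat.mod_eq_of_lt i.isLt]
    · simp [Nat.mod_eq_of_lt i.isLt]
  exact ⟨(Nat.sInf_mem ⟨n, hmem⟩).1, Nat.sInf_le hmem⟩

/-- A point returning to `[w]` at time `τ(w) ≤ n` has its `n`-th coordinate determined by `w`. -/
theorem exists_forall_hitTime'_eq_tau {n : ℕ} (hn : 1 ≤ n) (w : Fin n → A) :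
    ∃ c : A, ∀ y : X A, hitTime' A w y = tau A w → y n = c := by
  obtain ⟨h₁, h₂⟩ := tau_mem_Icc hn w
  refine ⟨w ⟨n - tau A w, by omega⟩, fun y hy => ?_⟩
  have hpos : 0 < hitTime' A w y := by omega
  have hret := (Nat.sInf_mem (Nat.nonempty_of_pos_sInf hpos)).2 ⟨n - tau A w, by omega⟩
  change y (hitTime' A w y + (n - tau A w)) = _ at hret
  rwa [hy, Nat.add_sub_cancel' h₂] at hret

theorem IsEqSt.le_zeta (hcard : 1 < Fintype.card A) {φ : X A → ℝ} (hφ : Continuous φ)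
    (hvar : Summable fun n => Var A φ (n + 1)) {μ : Measure (X A)} (hμ : IsEqSt A φ μ)
    {n : ℕ} (hn : 1 ≤ n) (w : Fin n → A) :
    Real.exp (-2 * ∑' k : ℕ, Var A φ (k + 1)) * Real.exp (⨅ x : X A, φ x) ≤ zeta A μ w := by
  have := hμ.1
  obtain ⟨c, hc⟩ := exists_forall_hitTime'_eq_tau hn w
  obtain ⟨b, hb⟩ := Fintype.exists_ne_of_one_lt_card hcard c
  have hsub : cyl A w ∩ {y | y n = b} ⊆ cyl A w ∩ {y | hitTime' A w y ≠ tau A w} :=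
    fun y hy => ⟨hy.1, fun h => hb (hy.2.symm.trans (hc y h))⟩
  have hlow := hμ.le_measureReal_cyl_inter_coord hφ hvar w b fun _ => b
  have hup := hμ.measureReal_cyl_le hφ hvar w fun _ => b
  have hpos : 0 < μ.real (cyl A w) :=
    lt_of_lt_of_le (by positivity) (hlow.trans (measureReal_mono inter_subset_left))
  have hle := hlow.trans (measureReal_mono hsub)
  set V := ∑' k : ℕ, Var A φ (k + 1)
  set m := Real.exp (⨅ x : X A, φ x)
  set s := birkhoffConcat φ w fun _ => b
  change _ ≤ μ.real _ / μ.real _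
  rw [le_div_iff₀ hpos]
  calc Real.exp (-2 * V) * m * μ.real (cyl A w)
      ≤ Real.exp (-2 * V) * m * (Real.exp V * Real.exp s) := by gcongr
    _ = Real.exp (-V) * Real.exp s * m := by
        rw [show -V = -2 * V + V by ring, Real.exp_add]
        ring
    _ ≤ _ := hle

end

/-- for the equilibrium state `μ_φ` of a normalized potential with
summable variation, `ζ_{μ_φ}(a_1^n) ≥ exp(-2 Σ_{k=1}^∞ var_k(φ)) e^{inf φ} > 0`
for all `n ≥ 1` and `a_1^n`; in particular `inf_n inf_{a_1^n} ζ_{μ_φ}(a_1^n) > 0`. -/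
theorem zeta_lower_bound_equilibrium
    (hcard : 1 < Fintype.card A)
    (φ : X A → ℝ) (hφc : Continuous φ)
    (hvar : Summable (fun n => Var A φ (n + 1)))
    (hnorm : Normalized A φ)
    (μφ : Measure (X A)) (hμ : IsEqSt A φ μφ) :
    (∀ (n : ℕ), 1 ≤ n → ∀ w : Fin n → A,
      Real.exp (-2 * ∑' k : ℕ, Var A φ (k + 1)) * Real.exp (⨅ x : X A, φ x)
        ≤ zeta A μφ w) ∧
    0 < Real.exp (-2 * ∑' k : ℕ, Var A φ (k + 1)) * Real.exp (⨅ x : X A, φ x) ∧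
    ∃ c : ℝ, 0 < c ∧ ∀ (n : ℕ), 1 ≤ n → ∀ w : Fin n → A, c ≤ zeta A μφ w := by
  have hpos : 0 < Real.exp (-2 * ∑' k : ℕ, Var A φ (k + 1)) * Real.exp (⨅ x : X A, φ x) := by
    positivity
  exact ⟨fun n hn w => hμ.le_zeta hcard hφc hvar hn w, hpos, _, hpos,
    fun n hn w => hμ.le_zeta hcard hφc hvar hn w⟩

end RTSpec
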